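/- arXiv:1001.1722 — 5 statements merged into one kernel-verified Lean document; each statement's English description precedes it below -/
import Mathlib

section
/- Let (L_k)_{k∈K} and (M_j)_{j∈J} be two finite families of m×n complex matrices such that for every n×n complex matrix ρ one has Σ_k L_k ρ L_k† = Σ_j M_j ρ M_j† (i.e. both families are Kraus decompositions of the same completely positive map). Then for every natural number p and every complex matrix σ indexed by (Fin n × Fin p) × (Fin n × Fin p), one has Σ_k (L_k ⊗ I_p) σ (L_k ⊗ I_p)† = Σ_j (M_j ⊗ I_p) σ (M_j ⊗ I_p)†. In other words, the extension of a completely positive map by the identity on an auxiliary system is independent of the chosen Kraus decomposition, so the map is well defined on entangled contexts. -/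
open Matrix Kronecker

/-- Conjugating by `A ⊗ 1` acts blockwise: on each block with fixed auxiliary indices it is
conjugation by `A`. -/
theorem kronecker_one_conj_apply {m n p R : Type*} [Fintype n] [Fintype p] [DecidableEq p]
    [CommSemiring R] [StarRing R] (A : Matrix m n R) (σ : Matrix (n × p) (n × p) R)
    (a b : m) (s t : p) :
    ((A ⊗ₖ (1 : Matrix p p R)) * σ * (A ⊗ₖ (1 : Matrix p p R))ᴴ) (a, s) (b, t) =
      (A * σ.submatrix (·, s) (·, t) * Aᴴ) a b := by
  simp [Matrix.mul_apply, Fintype.sum_prod_type, Matrix.one_apply, apply_ite]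

/-- **Kraus-decomposition independence of identity extensions.**
If two finite Kraus families `L` and `M` define the same completely positive map
`ρ ↦ Σ_k L_k ρ L_k†`, then their extensions by the identity on an auxiliary
`p`-dimensional system agree on every (possibly entangled) matrix `σ`. -/
theorem kraus_extension_well_defined {K J : Type*} [Fintype K] [Fintype J] {m n : ℕ}
    (L : K → Matrix (Fin m) (Fin n) ℂ) (M : J → Matrix (Fin m) (Fin n) ℂ)
    (h : ∀ ρ : Matrix (Fin n) (Fin n) ℂ,
      ∑ k, L k * ρ * (L k)ᴴ = ∑ j, M j * ρ * (M j)ᴴ)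
    (p : ℕ) (σ : Matrix (Fin n × Fin p) (Fin n × Fin p) ℂ) :
    ∑ k, (L k ⊗ₖ (1 : Matrix (Fin p) (Fin p) ℂ)) * σ * (L k ⊗ₖ (1 : Matrix (Fin p) (Fin p) ℂ))ᴴ
      = ∑ j, (M j ⊗ₖ (1 : Matrix (Fin p) (Fin p) ℂ)) * σ * (M j ⊗ₖ (1 : Matrix (Fin p) (Fin p) ℂ))ᴴ := by
  ext ⟨a, s⟩ ⟨b, t⟩
  simp only [Matrix.sum_apply, kronecker_one_conj_apply]
  simpa only [Matrix.sum_apply] using congr_fun₂ (h (σ.submatrix (·, s) (·, t))) a b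
end

section
/- For every column vector ψ ∈ ℂ² and every s ∈ {0,1}: X^s · (⟨+_s| ⊗ I₂) · CZ · (ψ ⊗ |+⟩) = (1/√2) · (H ψ). That is, each branch of the measurement-based Hadamard pattern — prepare the auxiliary qubit in |+⟩, entangle with CZ, measure the first qubit in the X basis with outcome s, and apply the correction X^s — produces the Hadamard image H ψ of the input, with the factor 1/√2 accounting for the branch probability; in particular the pattern is deterministic. -/
open Matrix Kronecker

noncomputable section

/-- standard basis column vector `e₀` -/
def ket0 : Matrix (Fin 2) (Fin 1) ℂ := !![1; 0]

/-- standard basis column vector `e₁` -/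
def ket1 : Matrix (Fin 2) (Fin 1) ℂ := !![0; 1]

/-- the state `|+⟩ = (e₀ + e₁)/√2` -/
def ketPlus : Matrix (Fin 2) (Fin 1) ℂ := (Real.sqrt 2 : ℂ)⁻¹ • (ket0 + ket1)

/-- the Hadamard gate -/
def qH : Matrix (Fin 2) (Fin 2) ℂ := (Real.sqrt 2 : ℂ)⁻¹ • !![1, 1; 1, -1]

/-- the Pauli `X` gate -/
def qX : Matrix (Fin 2) (Fin 2) ℂ := !![0, 1; 1, 0]

/-- the controlled-`Z` gate `diag(1,1,1,-1)` on two qubits -/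
def CZ : Matrix (Fin 2 × Fin 2) (Fin 2 × Fin 2) ℂ :=
  fun p q => if p = q then (if p = (1, 1) then -1 else 1) else 0

/-- the `X`-basis measurement bra `⟨+_s| = (1, (-1)^s)/√2` -/
def braPlus (s : Fin 2) : Matrix (Fin 1) (Fin 2) ℂ :=
  (Real.sqrt 2 : ℂ)⁻¹ • !![1, (-1 : ℂ) ^ (s : ℕ)]

/-- **Correctness of the measurement-based Hadamard pattern.**
For every input `ψ` and measurement outcome `s`, the branch
`X^s · (⟨+_s| ⊗ I₂) · CZ · (ψ ⊗ |+⟩)` equals `(1/√2) · H ψ`. -/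
theorem mbqc_hadamard_correct (ψ : Matrix (Fin 2) (Fin 1) ℂ) (s : Fin 2) :
    qX ^ (s : ℕ) *
      (Matrix.reindex (Equiv.uniqueProd (Fin 2) (Fin 1)) (Equiv.uniqueProd (Fin 1) (Fin 1))
        ((braPlus s ⊗ₖ (1 : Matrix (Fin 2) (Fin 2) ℂ)) * CZ * (ψ ⊗ₖ ketPlus)))
      = (Real.sqrt 2 : ℂ)⁻¹ • (qH * ψ) := by
  ext i j
  fin_cases s <;> fin_cases i <;> fin_cases j <;>
    simp [Matrix.mul_apply, Fintype.sum_prod_type, qX, qH, CZ, braPlus, ketPlus, ket0, ket1,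
      Matrix.one_apply, Matrix.vecMul, dotProduct] <;>
    ring

end
end

section
/- For every n ≥ 1, let G_n ∈ ℂ^{2^n} be the n-qubit GHZ (cat) state, i.e. the column vector with entry 1/√2 at indices 0 and 2^n − 1 and 0 elsewhere. Then (I_{2^{n-1}} ⊗ ((I₂ ⊗ H) · CZ)) · (G_n ⊗ |+⟩) = G_{n+1} (under the canonical identification ℂ^{2^n} ⊗ ℂ² ≅ ℂ^{2^{n+1}} by the Kronecker product indexing). That is, adjoining a fresh qubit in |+⟩, entangling it with the last qubit by CZ, and applying a Hadamard to it extends an n-qubit GHZ state to an (n+1)-qubit GHZ state; this is the inductive step showing that the n-fold GHZ pattern produces |0…0⟩+|1…1⟩. -/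
open Matrix Kronecker

noncomputable section

/-- the `n`-qubit GHZ (cat) state: entries `1/√2` at indices `0` and `2^n - 1`. -/
def ghz (n : ℕ) : Matrix (Fin (2 ^ n)) (Fin 1) ℂ :=
  fun x _ => if (x : ℕ) = 0 ∨ (x : ℕ) = 2 ^ n - 1 then (Real.sqrt 2 : ℂ)⁻¹ else 0

/-- The Hadamard gate after `CZ` on a target in `|+⟩` copies the control qubit. -/
lemma one_kronecker_qH_mul_CZ_apply (a b : Fin 2) (x : Fin 2 → ℂ) :
    ∑ a' : Fin 2, ∑ b' : Fin 2, (((1 : Matrix (Fin 2) (Fin 2) ℂ) ⊗ₖ qH) * CZ) (a, b) (a', b') *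
      (x a' * ketPlus b' 0) = if a = b then x a else 0 := by
  have h : ((Real.sqrt 2 : ℂ))⁻¹ * (Real.sqrt 2 : ℂ)⁻¹ = 1 / 2 := by
    rw [← mul_inv, ← Complex.ofReal_mul, Real.mul_self_sqrt zero_le_two]
    norm_num
  fin_cases a <;> fin_cases b <;>
    simp [Matrix.mul_apply, CZ, qH, ketPlus, ket0, ket1] <;>
    linear_combination (2 * x _) * h

/-- Appending a copy of the last bit preserves membership in the support of the GHZ state. -/
lemma ghz_append_apply (m : ℕ) (k : Fin (2 ^ m)) (a b : Fin 2) (i j : Fin 1) :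
    ghz (m + 2) (finProdFinEquiv ((finProdFinEquiv (k, a) : Fin (2 ^ (m + 1))), b)) i =
      if a = b then ghz (m + 1) (finProdFinEquiv (k, a)) j else 0 := by
  have hm : 0 < 2 ^ m := by positivity
  have h1 : 2 ^ (m + 1) = 2 * 2 ^ m := by ring
  have h2 : 2 ^ (m + 2) = 4 * 2 ^ m := by ring
  have hk := k.isLt
  fin_cases a <;> fin_cases b <;> simp only [ghz, finProdFinEquiv_apply_val, h1, h2] <;>
    simp <;> grind

/-- **Inductive step of the GHZ preparation pattern.**
For every `n = m + 1 ≥ 1`, adjoining a fresh qubit in `|+⟩`, entangling it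
with the last qubit by `CZ` and applying a Hadamard to it extends the
`n`-qubit GHZ state to the `(n+1)`-qubit GHZ state:
`(I_{2^{n-1}} ⊗ ((I₂ ⊗ H) · CZ)) · (G_n ⊗ |+⟩) = G_{n+1}`, under the
canonical Kronecker-product identifications of index types. -/
theorem ghz_extension (m : ℕ) :
    ((1 : Matrix (Fin (2 ^ m)) (Fin (2 ^ m)) ℂ) ⊗ₖ
        (((1 : Matrix (Fin 2) (Fin 2) ℂ) ⊗ₖ qH) * CZ)) *
      (Matrix.reindex
        (((finProdFinEquiv.symm : Fin (2 ^ (m + 1)) ≃ Fin (2 ^ m) × Fin 2).prodCongr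
            (Equiv.refl (Fin 2))).trans (Equiv.prodAssoc (Fin (2 ^ m)) (Fin 2) (Fin 2)))
        (Equiv.prodUnique (Fin 1) (Fin 1))
        (ghz (m + 1) ⊗ₖ ketPlus))
    = Matrix.reindex
        (((finProdFinEquiv.symm : Fin (2 ^ (m + 2)) ≃ Fin (2 ^ (m + 1)) × Fin 2).trans
            ((finProdFinEquiv.symm : Fin (2 ^ (m + 1)) ≃ Fin (2 ^ m) × Fin 2).prodCongr
              (Equiv.refl (Fin 2)))).trans (Equiv.prodAssoc (Fin (2 ^ m)) (Fin 2) (Fin 2)))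
        (Equiv.refl (Fin 1))
        (ghz (m + 2)) := by
  ext ⟨k, a, b⟩ j
  obtain rfl : j = 0 := Subsingleton.elim _ _
  rw [Matrix.mul_apply, Fintype.sum_prod_type, Finset.sum_eq_single k]
  · rw [Fintype.sum_prod_type]
    refine Eq.trans ?_ ((one_kronecker_qH_mul_CZ_apply a b
      fun a' => ghz (m + 1) (finProdFinEquiv (k, a')) 0).trans
        (ghz_append_apply m k a b 0 0).symm)
    refine Finset.sum_congr rfl fun a' _ => Finset.sum_congr rfl fun b' _ => ?_
    rw [Matrix.kroneckerMap_apply, Matrix.one_apply_eq, one_mul]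
    rfl
  · intro k' _ hk'
    simp [Matrix.one_apply_ne hk'.symm]
  · simp

end
end

section
/- Fix n ≥ 1. Let Φ_n = 2^{-n/2} Σ_{x=0}^{2^n−1} e_x ⊗ e_x ∈ ℂ^{2^n} ⊗ ℂ^{2^n}, the joint state of n Bell pairs with the local halves collected into the first factor and the halves held by the central server collected into the second factor. Fix a GHZ measurement outcome, given by i ∈ {0, …, 2^n − 1} and b ∈ {0,1}, and let ⟨g_{i,b}| = (e_i + (-1)^b e_{2^n−1−i})†/√2 be the corresponding GHZ-basis projection functional. Let C be the 2^n × 2^n correction matrix with entries C(y,x) = (-1)^{b·y_1} if y = x XOR i and 0 otherwise, where XOR is bitwise and y_1 is the most significant bit of y (i.e. C = (Z^b on the first qubit) composed with ⊗_k X^{i_k}). Then C · ((I ⊗ ⟨g_{i,b}|) Φ_n) = 2^{-n/2} G_n, where G_n = (e_0 + e_{2^n−1})/√2 is the n-qubit GHZ state. That is, for every outcome of the GHZ measurement on the server's halves, the corrected post-measurement state of the n agents' qubits is the n-qubit GHZ state, with every outcome occurring with probability 2^{-n}: this is the correctness of the n-party entanglement swapping protocol. -/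
open Matrix Kronecker

noncomputable section

/-- the joint state of `n` Bell pairs, `Φ_n = 2^{-n/2} Σ_x e_x ⊗ e_x`,
with the agents' halves collected in the first factor and the server's
halves in the second factor. -/
def bellPairs (n : ℕ) : Matrix (Fin (2 ^ n) × Fin (2 ^ n)) (Fin 1) ℂ :=
  fun p _ => if p.1 = p.2 then ((Real.sqrt 2 : ℂ)⁻¹) ^ n else 0

/-- the GHZ-basis projection functional
`⟨g_{i,b}| = (e_i + (-1)^b e_{2^n−1−i})†/√2`. -/
def braGHZ (n : ℕ) (i : Fin (2 ^ n)) (b : Fin 2) : Matrix (Fin 1) (Fin (2 ^ n)) ℂ :=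
  fun _ x =>
    ((if x = i then 1 else 0) +
        (-1 : ℂ) ^ (b : ℕ) * (if (x : ℕ) = 2 ^ n - 1 - (i : ℕ) then 1 else 0)) /
      (Real.sqrt 2 : ℂ)

/-- the Pauli correction `C` for GHZ measurement outcome `(i, b)`:
`C(y,x) = (-1)^{b·y₁}` if `y = x XOR i` and `0` otherwise, where `y₁` is the
most significant bit of `y` (i.e. `Z^b` on the first qubit composed with
`⊗_k X^{i_k}`). -/
def esCorrection (n : ℕ) (i : Fin (2 ^ n)) (b : Fin 2) :
    Matrix (Fin (2 ^ n)) (Fin (2 ^ n)) ℂ :=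
  fun y x =>
    if (y : ℕ) = (x : ℕ) ^^^ (i : ℕ) then
      (-1 : ℂ) ^ ((b : ℕ) * ((y : ℕ) / 2 ^ (n - 1))) else 0

theorem Nat.two_pow_sub_one_sub_eq_xor {n i : ℕ} (hi : i < 2 ^ n) :
    2 ^ n - 1 - i = (2 ^ n - 1) ^^^ i := by
  apply Nat.eq_of_testBit_eq
  intro k
  have h : 2 ^ n - 1 - i = 2 ^ n - (i + 1) := by omega
  rw [h, Nat.testBit_two_pow_sub_succ hi, Nat.testBit_xor, Nat.testBit_two_pow_sub_one]
  by_cases hk : k < n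
  · simp [hk]
  · have : i.testBit k = false :=
      Nat.testBit_lt_two_pow (hi.trans_le (Nat.pow_le_pow_right (by norm_num) (not_lt.mp hk)))
    simp [hk, this]

/-- The post-measurement state of the agents is the entrywise coefficient vector of the
projection functional, scaled by `2^{-n/2}`. -/
theorem reindex_kronecker_braGHZ_mul_bellPairs (n : ℕ) (i : Fin (2 ^ n)) (b : Fin 2)
    (x : Fin (2 ^ n)) (k : Fin 1) :
    Matrix.reindex (Equiv.prodUnique (Fin (2 ^ n)) (Fin 1)) (Equiv.refl (Fin 1))
      (((1 : Matrix (Fin (2 ^ n)) (Fin (2 ^ n)) ℂ) ⊗ₖ braGHZ n i b) * bellPairs n) x k =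
    ((Real.sqrt 2 : ℂ)⁻¹) ^ n * braGHZ n i b 0 x := by
  simp [Matrix.mul_apply, Fintype.sum_prod_type, bellPairs, Matrix.one_apply, mul_comm]

theorem esCorrection_mul_apply (n : ℕ) (i : Fin (2 ^ n)) (b : Fin 2)
    (v : Matrix (Fin (2 ^ n)) (Fin 1) ℂ) (y : Fin (2 ^ n)) (k : Fin 1) :
    (esCorrection n i b * v) y k =
      (-1 : ℂ) ^ ((b : ℕ) * ((y : ℕ) / 2 ^ (n - 1))) *
        v ⟨(y : ℕ) ^^^ (i : ℕ), Nat.xor_lt_two_pow y.isLt i.isLt⟩ k := by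
  rw [Matrix.mul_apply,
    Finset.sum_eq_single ⟨(y : ℕ) ^^^ (i : ℕ), Nat.xor_lt_two_pow y.isLt i.isLt⟩]
  · simp [esCorrection]
  · intro x _ hx
    have h : (y : ℕ) ≠ (x : ℕ) ^^^ (i : ℕ) := by
      intro h
      apply hx
      ext
      simp [h]
    simp [esCorrection, h]
  · simp

/-- **Correctness of the `n`-party entanglement swapping protocol.**
For every GHZ measurement outcome `(i, b)` on the server's halves of `n`
Bell pairs, the corrected post-measurement state of the agents' qubits is
`2^{-n/2} G_n`: every outcome occurs with probability `2^{-n}` and, after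
the correction, leaves the agents sharing the `n`-qubit GHZ state. -/
theorem entanglement_swapping_correct (n : ℕ) (hn : 1 ≤ n)
    (i : Fin (2 ^ n)) (b : Fin 2) :
    esCorrection n i b *
      (Matrix.reindex (Equiv.prodUnique (Fin (2 ^ n)) (Fin 1)) (Equiv.refl (Fin 1))
        (((1 : Matrix (Fin (2 ^ n)) (Fin (2 ^ n)) ℂ) ⊗ₖ braGHZ n i b) * bellPairs n))
    = ((Real.sqrt 2 : ℂ)⁻¹) ^ n • ghz n := by
  ext y k
  rw [esCorrection_mul_apply, reindex_kronecker_braGHZ_mul_bellPairs]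
  have hpos : 2 ^ n = 2 * 2 ^ (n - 1) := by
    rw [← pow_succ', Nat.sub_add_cancel hn]
  have hone : 1 ≤ 2 ^ (n - 1) := Nat.one_le_two_pow
  have hzero : (y : ℕ) ^^^ (i : ℕ) = (i : ℕ) ↔ (y : ℕ) = 0 := by
    simp
  have hlast : (y : ℕ) ^^^ (i : ℕ) = 2 ^ n - 1 - (i : ℕ) ↔ (y : ℕ) = 2 ^ n - 1 := by
    rw [Nat.two_pow_sub_one_sub_eq_xor i.isLt, Nat.xor_left_inj]
  simp only [braGHZ, ghz, Matrix.smul_apply, smul_eq_mul, Fin.ext_iff, hzero, hlast]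
  by_cases h0 : (y : ℕ) = 0
  · have h1 : (0 : ℕ) ≠ 2 ^ n - 1 := by omega
    simp [h0, h1]
  · by_cases h1 : (y : ℕ) = 2 ^ n - 1
    · have hdiv : (2 ^ n - 1) / 2 ^ (n - 1) = 1 := by
        apply Nat.div_eq_of_lt_le <;> omega
      have hsign : ((-1 : ℂ) ^ (b : ℕ)) * (-1) ^ (b : ℕ) = 1 := by
        rw [← mul_pow]; simp
      have h2 : 2 ^ n - 1 ≠ 0 := h1 ▸ h0
      simp only [h1, hdiv, h2, if_true, if_false, or_true, mul_one, zero_add]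
      rw [div_eq_mul_inv]
      linear_combination ((Real.sqrt 2 : ℂ)⁻¹) ^ n * (Real.sqrt 2 : ℂ)⁻¹ * hsign
    · simp [h0, h1]

end
end

section
/- Fix n ≥ 1 and let G_n = (e_0 + e_{2^n−1})/√2 ∈ ℂ^{2^n} be the n-qubit GHZ (cat) state shared between a leader (holding its first qubit) and n−1 agents. Let ψ = α e₀ + β e₁ ∈ ℂ² be a control qubit held by the leader. Then for each measurement outcome s ∈ {0,1}: (I₂ ⊗ (X^s)^{⊗(n−1)}) · (I₂ ⊗ ⟨s| ⊗ I_{2^{n−1}}) · (CNOT ⊗ I_{2^{n−1}}) · (ψ ⊗ G_n) = (1/√2)(α e₀^{⊗ n} + β e₁^{⊗ n}), where ⟨s| = e_s† and (X^s)^{⊗(n−1)} is the correction applied to the remaining n−1 GHZ qubits. That is, in the share-control protocol — CNOT from the control onto the leader's GHZ qubit, measurement of that qubit with outcome s broadcast to all agents, followed by X^s corrections — every branch deterministically produces the shared control state α|0⟩^{⊗n} + β|1⟩^{⊗n} on the control qubit together with the agents' qubits, each outcome occurring with probability 1/2. -/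
open Matrix Kronecker

noncomputable section

/-- the standard basis column vector `e_s` of `ℂ²` -/
def es (s : Fin 2) : Matrix (Fin 2) (Fin 1) ℂ := fun a _ => if a = s then 1 else 0

/-- the controlled-not gate, sending `e_a ⊗ e_b` to `e_a ⊗ e_{a ⊕ b}` -/
def CNOT : Matrix (Fin 2 × Fin 2) (Fin 2 × Fin 2) ℂ :=
  fun p q => if p.1 = q.1 ∧ p.2 = q.1 + q.2 then 1 else 0

/-- the `m`-fold Kronecker power `A^{⊗m}` of a one-qubit gate `A`,
under the canonical identification `Fin (2^m) × Fin 2 ≃ Fin (2^{m+1})`. -/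
def kronPow (A : Matrix (Fin 2) (Fin 2) ℂ) : (m : ℕ) → Matrix (Fin (2 ^ m)) (Fin (2 ^ m)) ℂ
  | 0 => 1
  | m + 1 => Matrix.reindex finProdFinEquiv finProdFinEquiv (kronPow A m ⊗ₖ A)

/-- the all-zeros basis state `e₀^{⊗m}` of `m` qubits -/
def allZeros (m : ℕ) : Matrix (Fin (2 ^ m)) (Fin 1) ℂ :=
  fun x _ => if (x : ℕ) = 0 then 1 else 0

/-- the all-ones basis state `e₁^{⊗m}` of `m` qubits -/
def allOnes (m : ℕ) : Matrix (Fin (2 ^ m)) (Fin 1) ℂ :=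
  fun x _ => if (x : ℕ) = 2 ^ m - 1 then 1 else 0

/-- `X^{⊗m}` is the matrix of the bitwise complement `y ↦ 2^m - 1 - y`. -/
lemma kronPow_qX_apply (m : ℕ) (x y : Fin (2 ^ m)) :
    kronPow qX m x y = if (x : ℕ) + y = 2 ^ m - 1 then 1 else 0 := by
  induction m with
  | zero =>
    obtain rfl : x = y := Fin.ext (by omega)
    simp [kronPow]
  | succ m ih =>
    have hX (a b : Fin 2) : qX a b = if (a : ℕ) + b = 1 then 1 else 0 := by
      fin_cases a <;> fin_cases b <;> simp [qX]
    change kronPow qX m (Fin.cast (pow_succ 2 m) x).divNat (Fin.cast (pow_succ 2 m) y).divNat *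
      qX (Fin.cast (pow_succ 2 m) x).modNat (Fin.cast (pow_succ 2 m) y).modNat = _
    rw [ih, hX, ite_zero_mul_ite_zero, one_mul]
    simp only [Fin.coe_divNat, Fin.coe_modNat, Fin.val_cast]
    have hm := Nat.one_le_two_pow (n := m)
    refine if_congr ?_ rfl rfl
    have hp : 2 ^ (m + 1) = 2 ^ m * 2 := pow_succ 2 m
    omega

lemma kronPow_one (m : ℕ) : kronPow 1 m = 1 := by
  induction m with
  | zero => rfl
  | succ m ih =>
    rw [kronPow, ih, one_kronecker_one, reindex_apply, submatrix_one_equiv]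
    rfl

lemma kronPow_qX_mul_allZeros (m : ℕ) : kronPow qX m * allZeros m = allOnes m := by
  ext x k
  rw [mul_apply, Finset.sum_eq_single ⟨0, by positivity⟩]
  · simp [kronPow_qX_apply, allZeros, allOnes]
  · intro y _ hy
    rw [allZeros, if_neg (fun h => hy (Fin.ext h)), mul_zero]
  · simp

lemma kronPow_qX_mul_allOnes (m : ℕ) : kronPow qX m * allOnes m = allZeros m := by
  have hm := Nat.one_le_two_pow (n := m)
  ext x k
  rw [mul_apply, Finset.sum_eq_single ⟨2 ^ m - 1, by omega⟩]
  · simp [kronPow_qX_apply, allZeros, allOnes]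
  · intro y _ hy
    simp only [ne_eq, Fin.ext_iff] at hy
    simp [allOnes, hy]
  · simp

/-- Splitting off the first qubit of the GHZ state. -/
lemma ghz_succ_apply (m : ℕ) (b : Fin 2) (x : Fin (2 ^ m)) (k : Fin 1) :
    ghz (m + 1) (Fin.cast (pow_succ' 2 m).symm (finProdFinEquiv (b, x))) k =
      (Real.sqrt 2 : ℂ)⁻¹ * (if b = 0 then allZeros m else allOnes m) x k := by
  have hm := Nat.one_le_two_pow (n := m)
  have hx := x.isLt
  have hp : 2 ^ (m + 1) = 2 * 2 ^ m := pow_succ' 2 m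
  fin_cases b
  · have h : ¬ (x : ℕ) = 2 ^ (m + 1) - 1 := by omega
    simp [ghz, allZeros, h]
  · have h : (x : ℕ) + 2 ^ m = 2 ^ (m + 1) - 1 ↔ (x : ℕ) = 2 ^ m - 1 := by omega
    simp [ghz, allOnes, h]

/-- **Correctness of the share-control protocol** (with `n = m + 1 ≥ 1`).
A CNOT from the control qubit `ψ = α e₀ + β e₁` onto the leader's qubit of
the GHZ state `G_n`, followed by a computational-basis measurement of that
qubit with outcome `s` and `X^s` corrections on the remaining `n − 1`
agents' qubits, deterministically yields `(1/√2)(α e₀^{⊗n} + β e₁^{⊗n})`,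
each branch occurring with probability `1/2`. -/
theorem share_control_correct (m : ℕ) (α β : ℂ) (s : Fin 2) :
    ((1 : Matrix (Fin 2) (Fin 2) ℂ) ⊗ₖ kronPow (qX ^ (s : ℕ)) m) *
      (Matrix.reindex
          ((Equiv.refl (Fin 2)).prodCongr (Equiv.uniqueProd (Fin (2 ^ m)) (Fin 1)))
          (Equiv.refl (Fin 1 × Fin 1))
        (((1 : Matrix (Fin 2) (Fin 2) ℂ) ⊗ₖ ((es s)ᴴ ⊗ₖ (1 : Matrix (Fin (2 ^ m)) (Fin (2 ^ m)) ℂ))) *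
          (Matrix.reindex (Equiv.prodAssoc (Fin 2) (Fin 2) (Fin (2 ^ m)))
              (Equiv.prodAssoc (Fin 2) (Fin 2) (Fin (2 ^ m)))
            (CNOT ⊗ₖ (1 : Matrix (Fin (2 ^ m)) (Fin (2 ^ m)) ℂ))) *
          (Matrix.reindex
              ((Equiv.refl (Fin 2)).prodCongr
                ((finCongr (pow_succ' 2 m)).trans
                  (finProdFinEquiv.symm : Fin (2 * 2 ^ m) ≃ Fin 2 × Fin (2 ^ m))))
              (Equiv.refl (Fin 1 × Fin 1))
            ((α • es 0 + β • es 1) ⊗ₖ ghz (m + 1)))))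
    = (Real.sqrt 2 : ℂ)⁻¹ •
        (α • (es 0 ⊗ₖ allZeros m) + β • (es 1 ⊗ₖ allOnes m)) := by
  have hmeas : Matrix.reindex
          ((Equiv.refl (Fin 2)).prodCongr (Equiv.uniqueProd (Fin (2 ^ m)) (Fin 1)))
          (Equiv.refl (Fin 1 × Fin 1))
        (((1 : Matrix (Fin 2) (Fin 2) ℂ) ⊗ₖ ((es s)ᴴ ⊗ₖ (1 : Matrix (Fin (2 ^ m)) (Fin (2 ^ m)) ℂ))) *
          (Matrix.reindex (Equiv.prodAssoc (Fin 2) (Fin 2) (Fin (2 ^ m)))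
              (Equiv.prodAssoc (Fin 2) (Fin 2) (Fin (2 ^ m)))
            (CNOT ⊗ₖ (1 : Matrix (Fin (2 ^ m)) (Fin (2 ^ m)) ℂ))) *
          (Matrix.reindex
              ((Equiv.refl (Fin 2)).prodCongr
                ((finCongr (pow_succ' 2 m)).trans
                  (finProdFinEquiv.symm : Fin (2 * 2 ^ m) ≃ Fin 2 × Fin (2 ^ m))))
              (Equiv.refl (Fin 1 × Fin 1))
            ((α • es 0 + β • es 1) ⊗ₖ ghz (m + 1)))) =
      (Real.sqrt 2 : ℂ)⁻¹ •
        (α • (es 0 ⊗ₖ (if s = 0 then allZeros m else allOnes m)) +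
          β • (es 1 ⊗ₖ (if s = 0 then allOnes m else allZeros m))) := by
    ext ⟨c, x⟩ ⟨k, l⟩
    rw [reindex_apply, submatrix_apply, Matrix.mul_assoc]
    simp only [mul_apply, Fintype.sum_prod_type, kroneckerMap_apply, reindex_apply,
      submatrix_apply, one_apply, conjTranspose_apply]
    fin_cases c <;> fin_cases s <;>
      simp [Fin.sum_univ_two, es, CNOT, ghz_succ_apply, mul_left_comm]
  rw [hmeas, Matrix.mul_smul, Matrix.mul_add, Matrix.mul_smul, Matrix.mul_smul,
    ← mul_kronecker_mul, ← mul_kronecker_mul, Matrix.one_mul, Matrix.one_mul]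
  fin_cases s
  · simp [kronPow_one]
  · simp [kronPow_qX_mul_allZeros, kronPow_qX_mul_allOnes]

end
end
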